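/- arXiv:2207.09776 — 2 statements merged into one kernel-verified Lean document; each statement's English description precedes it below -/
import Mathlib

section
/- Let c > 0 and define Γ₀(t,x,v) := (√3/(π t² c)) exp(−(2/c)(v²/t − 3vx/t² + 3x²/t³)) for t > 0 and (x,v) ∈ ℝ². Then for every bounded continuous function φ : ℝ² → ℝ, ∫_{ℝ²} Γ₀(t,x,v) φ(x,v) dx dv → φ(0,0) as t → 0⁺. -/
open MeasureTheory Real Filter

/-- The Gaussian-type kernel `Γ₀` of the Langevin equation. -/
noncomputable def Gamma0 (c t x v : ℝ) : ℝ :=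
  (Real.sqrt 3 / (π * t ^ 2 * c)) *
    Real.exp (-(2 / c) * (v ^ 2 / t - 3 * v * x / t ^ 2 + 3 * x ^ 2 / t ^ 3))

/-- The linear map `(y, z) ↦ (s³ y, s (z + 3 y / 2))`, which diagonalizes and rescales the quadratic
form of `Gamma0` at time `s²`. -/
noncomputable def kineticScaling (s : ℝ) : ℝ × ℝ →L[ℝ] ℝ × ℝ :=
  (Matrix.toLin (Module.Basis.finTwoProd ℝ) (Module.Basis.finTwoProd ℝ)
    !![s ^ 3, 0; s * (3 / 2), s]).toContinuousLinearMap

lemma kineticScaling_apply (s : ℝ) (p : ℝ × ℝ) :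
    kineticScaling s p = (s ^ 3 * p.1, s * (p.2 + 3 / 2 * p.1)) := by
  simp only [kineticScaling, Matrix.toLin_finTwoProd_toContinuousLinearMap]
  ext
  · simp
  · simp
    ring

lemma det_kineticScaling (s : ℝ) : (kineticScaling s).det = s ^ 4 := by
  rw [kineticScaling, LinearMap.det_toContinuousLinearMap, LinearMap.det_toLin,
    Matrix.det_fin_two_of]
  ring

lemma kineticScaling_injective {s : ℝ} (hs : 0 < s) : Function.Injective (kineticScaling s) := by
  rintro ⟨a, b⟩ ⟨a', b'⟩ h
  simp only [kineticScaling_apply, Prod.mk.injEq] at h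
  have h1 : a = a' := mul_left_cancel₀ (pow_ne_zero 3 hs.ne') h.1
  have h2 := mul_left_cancel₀ hs.ne' h.2
  ext
  · exact h1
  · dsimp only
    linarith

lemma kineticScaling_surjective {s : ℝ} (hs : 0 < s) : Function.Surjective (kineticScaling s) :=
  LinearMap.surjective_of_injective (f := (kineticScaling s).toLinearMap)
    (kineticScaling_injective hs)

lemma integral_eq_integral_kineticScaling {s : ℝ} (hs : 0 < s) (g : ℝ × ℝ → ℝ) :
    ∫ p, g p = ∫ p, s ^ 4 * g (kineticScaling s p) := by
  have h := integral_image_eq_integral_abs_det_fderiv_smul (volume : Measure (ℝ × ℝ))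
    MeasurableSet.univ (fun p _ => (kineticScaling s).hasFDerivWithinAt)
    (kineticScaling_injective hs).injOn g
  simpa [Set.image_univ, (kineticScaling_surjective hs).range_eq, det_kineticScaling,
    abs_of_pos hs] using h

lemma pow_four_mul_Gamma0_kineticScaling (c : ℝ) {s : ℝ} (hs : 0 < s) (p : ℝ × ℝ) :
    s ^ 4 * Gamma0 c (s ^ 2) (kineticScaling s p).1 (kineticScaling s p).2 =
      √3 / (π * c) * (exp (-(3 / (2 * c)) * p.1 ^ 2) * exp (-(2 / c) * p.2 ^ 2)) := by
  have hs' := hs.ne'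
  have hexp : (s * (p.2 + 3 / 2 * p.1)) ^ 2 / s ^ 2
      - 3 * (s * (p.2 + 3 / 2 * p.1)) * (s ^ 3 * p.1) / (s ^ 2) ^ 2
      + 3 * (s ^ 3 * p.1) ^ 2 / (s ^ 2) ^ 3 = p.2 ^ 2 + 3 / 4 * p.1 ^ 2 := by
    field_simp
    ring
  have hconst : √3 / (π * (s ^ 2) ^ 2 * c) = √3 / (π * c) / s ^ 4 := by
    rw [div_div]
    congr 1
    ring
  simp only [Gamma0, kineticScaling_apply]
  rw [hexp, hconst, ← exp_add, ← mul_assoc, mul_div_cancel₀ _ (pow_ne_zero 4 hs')]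
  congr 2
  rw [mul_comm 2 c, ← div_div]
  ring

lemma integral_gaussian_profile {c : ℝ} (hc : 0 < c) :
    ∫ p : ℝ × ℝ, √3 / (π * c) * (exp (-(3 / (2 * c)) * p.1 ^ 2) * exp (-(2 / c) * p.2 ^ 2)) = 1 := by
  have h := integral_prod_mul (μ := (volume : Measure ℝ)) (ν := (volume : Measure ℝ))
    (fun y : ℝ => exp (-(3 / (2 * c)) * y ^ 2)) (fun z : ℝ => exp (-(2 / c) * z ^ 2))
  rw [integral_const_mul, Measure.volume_eq_prod, h, integral_gaussian, integral_gaussian,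
    ← Real.sqrt_mul (by positivity)]
  have h2 : π / (3 / (2 * c)) * (π / (2 / c)) = (π * c) ^ 2 / 3 := by
    field_simp
  rw [h2, Real.sqrt_div (by positivity), Real.sqrt_sq (by positivity)]
  field_simp

lemma integrable_gaussian_profile {c : ℝ} (hc : 0 < c) :
    Integrable (fun p : ℝ × ℝ =>
      √3 / (π * c) * (exp (-(3 / (2 * c)) * p.1 ^ 2) * exp (-(2 / c) * p.2 ^ 2))) := by
  have h1 := integrable_exp_neg_mul_sq (b := 3 / (2 * c)) (by positivity)
  have h2 := integrable_exp_neg_mul_sq (b := 2 / c) (by positivity)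
  exact (h1.mul_prod h2).const_mul _

/-- Approximate-identity property of `Γ₀` at its pole: for every bounded continuous
`φ : ℝ² → ℝ`, `∫_{ℝ²} Γ₀(t,x,v) φ(x,v) dx dv → φ(0,0)` as `t → 0⁺`. -/
theorem Gamma0_approximate_identity (c : ℝ) (hc : 0 < c)
    (φ : ℝ × ℝ → ℝ) (hφ : Continuous φ) (hφb : ∃ C : ℝ, ∀ p : ℝ × ℝ, |φ p| ≤ C) :
    Tendsto (fun t : ℝ => ∫ p : ℝ × ℝ, Gamma0 c t p.1 p.2 * φ p)
      (nhdsWithin 0 (Set.Ioi 0)) (nhds (φ (0, 0))) := by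
  obtain ⟨C, hC⟩ := hφb
  set k : ℝ × ℝ → ℝ := fun p =>
    √3 / (π * c) * (exp (-(3 / (2 * c)) * p.1 ^ 2) * exp (-(2 / c) * p.2 ^ 2)) with hk
  have hk0 : ∀ p, 0 ≤ k p := fun p => by
    simp only [hk]
    positivity
  have hkc : Continuous k := by fun_prop
  have hlim : Tendsto (fun t : ℝ => ∫ p, k p * φ (kineticScaling (√t) p))
      (nhdsWithin 0 (Set.Ioi 0)) (nhds (∫ p, k p * φ (0, 0))) := by
    refine tendsto_integral_filter_of_dominated_convergence (fun p => k p * C) ?_ ?_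
      ((integrable_gaussian_profile hc).mul_const C) ?_
    · exact Eventually.of_forall fun t =>
        (hkc.mul (hφ.comp (kineticScaling (√t)).continuous)).aestronglyMeasurable
    · refine Eventually.of_forall fun t => Eventually.of_forall fun p => ?_
      rw [norm_mul, Real.norm_of_nonneg (hk0 p)]
      exact mul_le_mul_of_nonneg_left (hC _) (hk0 p)
    · refine Eventually.of_forall fun p => ?_
      have hcont : Continuous fun t : ℝ => k p * φ (kineticScaling (√t) p) := by
        simp only [kineticScaling_apply]
        fun_prop
      have h := hcont.tendsto 0
      simp only [kineticScaling_apply, Real.sqrt_zero, zero_mul, ne_eq, OfNat.ofNat_ne_zero,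
        not_false_eq_true, zero_pow] at h
      simpa only [kineticScaling_apply] using h.mono_left nhdsWithin_le_nhds
  rw [integral_mul_const, integral_gaussian_profile hc, one_mul] at hlim
  refine hlim.congr' ?_
  filter_upwards [self_mem_nhdsWithin] with t ht
  have hs : 0 < √t := Real.sqrt_pos.2 ht
  rw [integral_eq_integral_kineticScaling hs fun p => Gamma0 c t p.1 p.2 * φ p]
  refine integral_congr_ae (Eventually.of_forall fun p => ?_)
  have h := pow_four_mul_Gamma0_kineticScaling c hs p
  rw [Real.sq_sqrt (le_of_lt ht)] at h
  simp only [hk]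
  rw [← h, mul_assoc]
end

section
/- Let c > 0, let φ : ℝ² → ℝ be bounded and continuous, and define u(t,x,v) := ∫_{ℝ²} Γ₀(t, x − ξ − tη, v − η) φ(ξ,η) dξ dη for t > 0, where Γ₀(t,x,v) := (√3/(π t² c)) exp(−(2/c)(v²/t − 3vx/t² + 3x²/t³)). Then for every fixed (x,v) ∈ ℝ², u(t,x,v) → φ(x,v) as t → 0⁺. -/
open MeasureTheory Real Filter

/-- The solution of the Cauchy problem for the Langevin equation obtained by integrating
the fundamental solution against the initial datum `φ`. -/
noncomputable def langevinSol (c : ℝ) (φ : ℝ × ℝ → ℝ) (t x v : ℝ) : ℝ :=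
  ∫ p : ℝ × ℝ, Gamma0 c t (x - p.1 - t * p.2) (v - p.2) * φ p

/-- Change of variables for an invertible affine map of the plane. -/
theorem integral_comp_affine_prod (f : ℝ × ℝ → ℝ) (a b d e : ℝ) (r : ℝ × ℝ)
    (h : a * e - b * d ≠ 0) :
    ∫ p : ℝ × ℝ, f p =
      ∫ p : ℝ × ℝ, |a * e - b * d| *
        f (a * p.1 + b * p.2 + r.1, d * p.1 + e * p.2 + r.2) := by
  let L : ℝ × ℝ →L[ℝ] ℝ × ℝ := LinearMap.toContinuousLinearMap
    (Matrix.toLin (Module.Basis.finTwoProd ℝ) (Module.Basis.finTwoProd ℝ) !![a, b; d, e])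
  have hL : ∀ p, L p = (a * p.1 + b * p.2, d * p.1 + e * p.2) := fun p => by
    simp [L, Matrix.toLin_finTwoProd_apply]
  have hdet : L.det = a * e - b * d := by
    simp [L, ContinuousLinearMap.det, Matrix.det_fin_two_of]
  have hbij : Function.Bijective L :=
    (L.toContinuousLinearEquivOfDetNeZero (hdet ▸ h)).bijective
  have hbij' : Function.Bijective fun p => L p + r :=
    (Equiv.addRight r).bijective.comp hbij
  have key := integral_image_eq_integral_abs_det_fderiv_smul volume MeasurableSet.univ
    (f := fun p => L p + r) (f' := fun _ => L)
    (fun p _ => (L.hasFDerivAt.add_const r).hasFDerivWithinAt) hbij'.injective.injOn f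
  rw [Set.image_univ, hbij'.surjective.range_eq, setIntegral_univ, setIntegral_univ] at key
  simpa [hdet, hL, Prod.add_def] using key

/-- The kernel `Γ₀` at time `1` in the variables that diagonalise its exponent. -/
noncomputable def standardKernel (c : ℝ) (p : ℝ × ℝ) : ℝ :=
  (√3 / (π * c)) * (Real.exp (-(6 / c) * p.1 ^ 2) * Real.exp (-(1 / (2 * c)) * p.2 ^ 2))

theorem integrable_standardKernel {c : ℝ} (hc : 0 < c) : Integrable (standardKernel c) :=
  ((integrable_exp_neg_mul_sq (by positivity)).mul_prod
    (integrable_exp_neg_mul_sq (by positivity))).const_mul _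

theorem integral_standardKernel {c : ℝ} (hc : 0 < c) : ∫ p, standardKernel c p = 1 := by
  unfold standardKernel
  rw [integral_const_mul, Measure.volume_eq_prod,
    integral_prod_mul (fun y : ℝ => Real.exp (-(6 / c) * y ^ 2))
      (fun z : ℝ => Real.exp (-(1 / (2 * c)) * z ^ 2)),
    integral_gaussian, integral_gaussian, ← Real.sqrt_mul (by positivity)]
  have : π / (6 / c) * (π / (1 / (2 * c))) = (π * c) ^ 2 / 3 := by field_simp; norm_num
  rw [this, Real.sqrt_div (by positivity), Real.sqrt_sq (by positivity)]
  field_simp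

theorem langevinSol_eq_integral_standardKernel {c : ℝ} (hc : 0 < c) (φ : ℝ × ℝ → ℝ)
    {t : ℝ} (ht : 0 < t) (x v : ℝ) :
    langevinSol c φ t x v = ∫ p : ℝ × ℝ, standardKernel c p *
      φ (-√t ^ 3 * p.1 + √t ^ 3 / 2 * p.2 + (x - t * v), 0 * p.1 + -√t * p.2 + v) := by
  obtain ⟨s, hs, rfl⟩ : ∃ s : ℝ, 0 < s ∧ s ^ 2 = t :=
    ⟨√t, Real.sqrt_pos.2 ht, Real.sq_sqrt ht.le⟩
  rw [Real.sqrt_sq hs.le]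
  have hdet : -s ^ 3 * -s - s ^ 3 / 2 * 0 = s ^ 4 := by ring
  rw [langevinSol, integral_comp_affine_prod _ (-s ^ 3) (s ^ 3 / 2) 0 (-s) (x - s ^ 2 * v, v)
    (by rw [hdet]; positivity), hdet, abs_of_pos (by positivity)]
  congr 1 with p
  rw [← mul_assoc]
  congr 1
  rw [Gamma0, standardKernel, ← Real.exp_add, ← mul_assoc]
  congr 1
  · field_simp
  · congr 1
    field_simp
    ring

/-- For `c > 0` and a bounded continuous initial datum `φ`, the convolution
`u(t,x,v) = ∫_{ℝ²} Γ₀(t, x − ξ − tη, v − η) φ(ξ,η) dξ dη` attains the initial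
datum: `u(t,x,v) → φ(x,v)` as `t → 0⁺`, for every fixed `(x,v) ∈ ℝ²`. -/
theorem langevinSol_attains_initial_datum (c : ℝ) (hc : 0 < c)
    (φ : ℝ × ℝ → ℝ) (hφ : Continuous φ) (hφb : ∃ C : ℝ, ∀ p : ℝ × ℝ, |φ p| ≤ C)
    (x v : ℝ) :
    Tendsto (fun t : ℝ => langevinSol c φ t x v)
      (nhdsWithin 0 (Set.Ioi 0)) (nhds (φ (x, v))) := by
  obtain ⟨C, hC⟩ := hφb
  have hlim : Tendsto (fun t : ℝ => ∫ p : ℝ × ℝ, standardKernel c p *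
      φ (-√t ^ 3 * p.1 + √t ^ 3 / 2 * p.2 + (x - t * v), 0 * p.1 + -√t * p.2 + v))
      (nhdsWithin 0 (Set.Ioi 0)) (nhds (∫ p, standardKernel c p * φ (x, v))) := by
    refine tendsto_integral_filter_of_dominated_convergence
      (fun p => ‖standardKernel c p‖ * C) ?_ ?_ ((integrable_standardKernel hc).norm.mul_const C) ?_
    · refine Eventually.of_forall fun t => ?_
      exact (integrable_standardKernel hc).aestronglyMeasurable.mul
        (hφ.comp (by fun_prop)).aestronglyMeasurable
    · refine Eventually.of_forall fun t => Eventually.of_forall fun p => ?_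
      rw [norm_mul]
      exact mul_le_mul_of_nonneg_left (hC _) (norm_nonneg _)
    · refine Eventually.of_forall fun p => ?_
      have hcont : Continuous fun t : ℝ => standardKernel c p *
          φ (-√t ^ 3 * p.1 + √t ^ 3 / 2 * p.2 + (x - t * v), 0 * p.1 + -√t * p.2 + v) :=
        continuous_const.mul (hφ.comp (by fun_prop))
      simpa using (hcont.tendsto 0).mono_left nhdsWithin_le_nhds
  rw [integral_mul_const, integral_standardKernel hc, one_mul] at hlim
  refine hlim.congr' ?_
  filter_upwards [self_mem_nhdsWithin] with t ht
  exact (langevinSol_eq_integral_standardKernel hc φ ht x v).symm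
end
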